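/- For every real constant K > 0 and every integer k ≥ 3 there exists a threshold n₀ = n₀(K, k) such that the following holds. If A is a finite set of real numbers with |A| = n ≥ n₀ and the full sumset satisfies |A + A| ≤ K·|A|, then A contains a k-term arithmetic progression, i.e., there exist x and d ≠ 0 with x + i·d ∈ A for all integers 0 ≤ i ≤ k−1. -/

import Mathlib

open Pointwise

namespace DHJ

open Combinatorics

/-- Indicator of a proposition. -/
noncomputable def ind (p : Prop) : ℝ := by
  classical exact if p then 1 else 0

lemma ind_true {p : Prop} (h : p) : ind p = 1 := by simp [ind, h]
lemma ind_false {p : Prop} (h : ¬ p) : ind p = 0 := by simp [ind, h]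
lemma ind_nonneg (p : Prop) : 0 ≤ ind p := by
  by_cases h : p <;> simp [ind, h]
lemma ind_le_one (p : Prop) : ind p ≤ 1 := by
  by_cases h : p <;> simp [ind, h]
lemma ind_and (p q : Prop) : ind (p ∧ q) = ind p * ind q := by
  by_cases h : p <;> by_cases h' : q <;> simp [ind, h, h']
lemma ind_mono {p q : Prop} (h : p → q) : ind p ≤ ind q := by
  by_cases hp : p
  · rw [ind_true hp, ind_true (h hp)]
  · rw [ind_false hp]; exact ind_nonneg q

/-- Average of a function over a finite type. -/
noncomputable def av {X : Type*} [Finite X] (f : X → ℝ) : ℝ :=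
  letI := Fintype.ofFinite X
  (∑ x, f x) / (Nat.card X : ℝ)

section av
variable {X Y : Type*} [Finite X] [Finite Y]

lemma av_eq [Fintype X] (f : X → ℝ) : av f = (∑ x, f x) / (Fintype.card X : ℝ) := by
  unfold av
  rw [Nat.card_eq_fintype_card]
  congr!

lemma av_add (f g : X → ℝ) : av (fun x => f x + g x) = av f + av g := by
  unfold av; rw [Finset.sum_add_distrib, add_div]

lemma av_sub (f g : X → ℝ) : av (fun x => f x - g x) = av f - av g := by
  unfold av; rw [Finset.sum_sub_distrib, sub_div]

lemma av_mul (c : ℝ) (f : X → ℝ) : av (fun x => c * f x) = c * av f := by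
  unfold av; rw [← Finset.mul_sum, mul_div_assoc]

lemma av_sum {T : Type*} (s : Finset T) (f : T → X → ℝ) :
    av (fun x => ∑ t ∈ s, f t x) = ∑ t ∈ s, av (f t) := by
  unfold av; rw [Finset.sum_comm, Finset.sum_div]

lemma av_const [Nonempty X] (c : ℝ) : av (fun _ : X => c) = c := by
  have : Fintype X := Fintype.ofFinite X
  rw [av_eq]
  have : (Fintype.card X : ℝ) ≠ 0 := by
    exact_mod_cast Fintype.card_ne_zero
  simp [this]

lemma av_mono {f g : X → ℝ} (h : ∀ x, f x ≤ g x) : av f ≤ av g := by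
  unfold av
  gcongr
  exact h _

lemma av_nonneg {f : X → ℝ} (h : ∀ x, 0 ≤ f x) : 0 ≤ av f := by
  unfold av
  apply div_nonneg (Finset.sum_nonneg fun x _ => h x) (by positivity)

lemma exists_av_le [Nonempty X] (f : X → ℝ) : ∃ x, av f ≤ f x := by
  by_contra! h
  have : Fintype X := Fintype.ofFinite X
  have h1 : ∑ x, f x < ∑ _x : X, av f :=
    Finset.sum_lt_sum_of_nonempty Finset.univ_nonempty fun x _ => h x
  have h2 : (0:ℝ) < Fintype.card X := by exact_mod_cast Fintype.card_pos
  simp at h1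
  rw [av_eq] at h1
  have h3 : (Fintype.card X : ℝ) * ((∑ x, f x) / (Fintype.card X : ℝ)) = ∑ x, f x := by field_simp
  linarith

lemma av_equiv (e : X ≃ Y) (f : Y → ℝ) : av (fun x => f (e x)) = av f := by
  have : Fintype X := Fintype.ofFinite X
  have : Fintype Y := Fintype.ofFinite Y
  rw [av_eq, av_eq, Fintype.card_congr e, Equiv.sum_comp e f]

lemma av_prod (f : X × Y → ℝ) : av f = av fun x => av fun y => f (x, y) := by
  have : Fintype X := Fintype.ofFinite X
  have : Fintype Y := Fintype.ofFinite Y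
  simp only [av_eq]
  rw [Fintype.sum_prod_type, Fintype.card_prod, ← Finset.sum_div, div_div]
  push_cast
  rw [mul_comm]

lemma av_comm (f : X → Y → ℝ) : (av fun x => av fun y => f x y) = av fun y => av fun x => f x y := by
  rw [← av_prod (fun p : X × Y => f p.1 p.2), ← av_prod (fun p : Y × X => f p.2 p.1),
    ← av_equiv (Equiv.prodComm X Y)]
  rfl

lemma av_sumElim {ι κ α : Type*} [Finite ι] [Finite κ] [Finite α] (f : (ι ⊕ κ → α) → ℝ) :
    av f = av fun x : ι → α => av fun y : κ → α => f (Sum.elim x y) := by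
  rw [← av_prod (fun p : (ι → α) × (κ → α) => f (Sum.elim p.1 p.2)),
    ← av_equiv (Equiv.sumArrowEquivProdArrow ι κ α).symm]
  rfl

end av

/-- Density of a set. -/
noncomputable def dens {X : Type*} [Finite X] (A : Set X) : ℝ := av fun x => ind (x ∈ A)

lemma dens_nonneg {X : Type*} [Finite X] (A : Set X) : 0 ≤ dens A := av_nonneg fun _ => ind_nonneg _

lemma dens_le_one {X : Type*} [Finite X] (A : Set X) : dens A ≤ 1 := by
  cases isEmpty_or_nonempty X
  · simp [dens, av]
  · calc dens A ≤ av (fun _ : X => (1:ℝ)) := av_mono fun x => ind_le_one _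
      _ = 1 := av_const 1

/-- Pigeonhole principle for configurations. -/
lemma pigeon_aux {X Y U : Type*} [Finite X] [Finite Y] [Finite U] [Nonempty Y] (δ : ℝ) (hδ : 0 < δ)
    (R : X → Y → Prop) (inc : U → X → Prop)
    (hU : ∀ y, δ / 2 ≤ dens {x | R x y} → ∃ u, ∀ x, inc u x → R x y)
    (hR : δ ≤ av fun x => av fun y => ind (R x y)) :
    ∃ u, δ / 2 / (Nat.card U : ℝ) ≤ dens {y | ∀ x, inc u x → R x y} := by
  have : Fintype U := Fintype.ofFinite U
  have h1 : ∀ y, (av fun x => ind (R x y)) ≤ δ / 2 + ∑ u : U, ind (∀ x, inc u x → R x y) := by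
    intro y
    by_cases h : δ / 2 ≤ dens {x | R x y}
    · obtain ⟨u, hu⟩ := hU y h
      have h2 : (1:ℝ) ≤ ∑ u : U, ind (∀ x, inc u x → R x y) := by
        calc (1:ℝ) = ind (∀ x, inc u x → R x y) := (ind_true hu).symm
          _ ≤ _ := Finset.single_le_sum (f := fun u => ind (∀ x, inc u x → R x y))
            (fun i _ => ind_nonneg _) (Finset.mem_univ u)
      have h3 := dens_le_one {x | R x y}
      have : dens {x | R x y} = av fun x => ind (R x y) := rfl
      linarith
    · have : dens {x | R x y} = av fun x => ind (R x y) := rfl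
      have h2 : (0:ℝ) ≤ ∑ u : U, ind (∀ x, inc u x → R x y) :=
        Finset.sum_nonneg fun i _ => ind_nonneg _
      linarith
  rw [av_comm] at hR
  have h2 := hR.trans (av_mono h1)
  rw [av_add, av_const, av_sum] at h2
  by_contra! hcon
  rcases isEmpty_or_nonempty U with hE | hE
  · simp at h2; linarith
  have h3 : ∑ u : U, (av fun y => ind (∀ x, inc u x → R x y))
      < ∑ u : U, δ / 2 / (Nat.card U : ℝ) :=
    Finset.sum_lt_sum_of_nonempty Finset.univ_nonempty fun u _ => hcon u
  have h4 : (0:ℝ) < Fintype.card U := by exact_mod_cast Fintype.card_pos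
  have h5 : ∑ u : U, δ / 2 / (Nat.card U : ℝ) = δ / 2 := by
    simp; field_simp
  linarith

lemma pigeon {X Y U : Type*} [Finite X] [Finite Y] [Finite U] [Nonempty Y] (δ : ℝ) (hδ : 0 < δ)
    (R : X → Y → Prop) (inc : U → X → Prop)
    (hU : ∀ y, δ / 2 ≤ dens {x | R x y} → ∃ u, ∀ x, inc u x → R x y)
    (hR : δ ≤ av fun x => av fun y => ind (R x y)) :
    ∃ u, δ / 2 / (Nat.card U + 1 : ℝ) ≤ dens {y | ∀ x, inc u x → R x y} := by
  obtain ⟨u, hu⟩ := pigeon_aux δ hδ R inc hU hR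
  refine ⟨u, le_trans ?_ hu⟩
  have : Nonempty U := ⟨u⟩
  have : (0:ℝ) < Nat.card U := by exact_mod_cast Nat.card_pos
  gcongr
  linarith

/-- Swapping involution. -/
lemma exists_swap {α Λ : Type*} (e : α → Λ) (he : Function.Injective e) :
    ∃ σ : (Λ × α) ≃ (Λ × α), (∀ a b, σ (e a, b) = (e b, a)) ∧
      ∀ l b, l ∉ Set.range e → σ (l, b) = (l, b) := by
  classical
  let s : Λ × α → Λ × α := fun p =>
    if h : p.1 ∈ Set.range e then (e p.2, h.choose) else p
  have h1 : ∀ a b, s (e a, b) = (e b, a) := by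
    intro a b
    have h : e a ∈ Set.range e := ⟨a, rfl⟩
    simp only [s, dif_pos h]
    rw [he h.choose_spec]
  have h2 : ∀ l b, l ∉ Set.range e → s (l, b) = (l, b) := by
    intro l b h
    simp only [s]; rw [dif_neg h]
  have h3 : Function.Involutive s := by
    rintro ⟨l, b⟩
    by_cases h : l ∈ Set.range e
    · obtain ⟨a, rfl⟩ := h
      rw [h1, h1]
    · rw [h2 l b h, h2 l b h]
  exact ⟨h3.toPerm, h1, h2⟩

/-- Gluing. -/
noncomputable def glue {ι Λ α : Type*} (e : α → Λ) (J : Set ι) (z : ι → Λ) (x : J → α) : ι → Λ := by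
  classical exact fun i => if h : i ∈ J then e (x ⟨i, h⟩) else z i

lemma glue_mem {ι Λ α : Type*} (e : α → Λ) (J : Set ι) (z : ι → Λ) (x : J → α) (i : ι) (h : i ∈ J) :
    glue e J z x i = e (x ⟨i, h⟩) := by simp [glue, h]

lemma glue_not_mem {ι Λ α : Type*} (e : α → Λ) (J : Set ι) (z : ι → Λ) (x : J → α) (i : ι)
    (h : i ∉ J) : glue e J z x i = z i := by simp [glue, h]

lemma av_restrict {ι α : Type*} [Finite ι] [Finite α] [Nonempty α] (J : Set ι) (g : (J → α) → ℝ) :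
    (av fun x : ι → α => g (fun i => x i)) = av g := by
  classical
  have h := av_equiv (Equiv.piEquivPiSubtypeProd (fun i => i ∈ J) (fun _ : ι => α)) (fun p => g p.1)
  rw [av_prod] at h
  simp only [av_const] at h
  exact h

lemma resample {ι Λ α : Type*} [Finite ι] [Finite Λ] [Finite α] [Nonempty α] (e : α → Λ)
    (he : Function.Injective e) (f : (ι → Λ) → ℝ) :
    av f = av fun u : ι → Λ => av fun x : ({i | u i ∈ Set.range e} : Set ι) → α =>
      f (glue e {i | u i ∈ Set.range e} u x) := by
  obtain ⟨σ, h1, h2⟩ := exists_swap e he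
  let τ : ((ι → Λ) × (ι → α)) ≃ ((ι → Λ) × (ι → α)) :=
    (Equiv.arrowProdEquivProdArrow ι (fun _ => Λ) (fun _ => α)).symm.trans
      ((Equiv.arrowCongr (Equiv.refl ι) σ).trans
        (Equiv.arrowProdEquivProdArrow ι (fun _ => Λ) (fun _ => α)))
  have h3 := av_equiv τ (fun p => f p.1)
  rw [av_prod, av_prod] at h3
  simp only [av_const] at h3
  rw [← h3]
  congr 1
  funext u
  rw [← av_restrict]
  congr 1
  funext x
  congr 1
  funext i
  have h4 : (τ (u, x)).1 i = (σ (u i, x i)).1 := rfl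
  rw [h4]
  by_cases h : u i ∈ Set.range e
  · rw [glue_mem e {i | u i ∈ Set.range e} u _ i h]
    obtain ⟨a, ha⟩ := h
    have h5 : (σ (u i, x i)).1 = e (x i) := by rw [← ha, h1]
    exact h5
  · rw [glue_not_mem e {i | u i ∈ Set.range e} u _ i h, h2 _ _ h]

lemma few_small {Λ : Type*} [Finite Λ] (R : Set Λ) (hR : R.Nonempty) (m : ℕ) (ε : ℝ) (hε : 0 < ε) :
    ∃ n₀ : ℕ, ∀ (ι : Type) [Finite ι], n₀ ≤ Nat.card ι →
      (av fun u : ι → Λ => ind (Nat.card {i | u i ∈ R} < m)) ≤ ε := by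
  classical
  have : Fintype Λ := Fintype.ofFinite Λ
  obtain ⟨r, hr⟩ := hR
  have hc : (1:ℝ) ≤ Fintype.card Λ := by
    exact_mod_cast Fintype.card_pos_iff.2 ⟨r⟩
  set q : ℝ := (Fintype.card Λ - 1 / 2) / Fintype.card Λ with hq
  have hq0 : 0 ≤ q := by rw [hq]; apply div_nonneg <;> linarith
  have hq1 : q < 1 := by rw [hq, div_lt_one] <;> linarith
  obtain ⟨n₀, hn₀⟩ := exists_pow_lt_of_lt_one (show 0 < ε / 2 ^ m by positivity) hq1
  refine ⟨n₀, fun ι _ hι => ?_⟩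
  have : Fintype ι := Fintype.ofFinite ι
  let w : Λ → ℝ := fun l => if l ∈ R then 1 / 2 else 1
  have hw : ∑ l, w l ≤ Fintype.card Λ - 1 / 2 := by
    have h1 : ∀ l, w l ≤ 1 - (if l = r then 1 / 2 else 0) := by
      intro l
      by_cases h : l = r
      · subst h; simp [w, hr]; norm_num
      · simp only [w, h, if_false]; split_ifs <;> norm_num
    calc ∑ l, w l ≤ ∑ l, (1 - (if l = r then 1 / 2 else 0) : ℝ) := Finset.sum_le_sum fun l _ => h1 l
      _ = _ := by simp [Finset.sum_sub_distrib]
  have hw0 : 0 ≤ ∑ l, w l := Finset.sum_nonneg fun l _ => by simp only [w]; split_ifs <;> norm_num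
  have hav : (av fun u : ι → Λ => ∏ i, w (u i)) ≤ q ^ (Nat.card ι) := by
    rw [av_eq, Fintype.card_fun]
    have h2 : ∑ u : ι → Λ, ∏ i, w (u i) = (∑ l, w l) ^ (Fintype.card ι) := by
      have := Finset.prod_univ_sum (fun _ : ι => (Finset.univ : Finset Λ)) (fun _ l => w l)
      rw [Fintype.piFinset_univ] at this
      rw [← this]; simp
    rw [h2, hq, div_pow, Nat.card_eq_fintype_card]
    push_cast
    gcongr
  have hpt : ∀ u : ι → Λ, ind (Nat.card {i | u i ∈ R} < m) ≤ 2 ^ m * ∏ i, w (u i) := by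
    intro u
    have h3 : ∏ i, w (u i) = (1 / 2) ^ (Nat.card {i | u i ∈ R}) := by
      simp only [w]
      rw [Finset.prod_ite]
      simp [Fintype.card_subtype]
    rw [h3]
    by_cases h : Nat.card {i | u i ∈ R} < m
    · rw [ind_true h]
      have : (2:ℝ) ^ (Nat.card {i | u i ∈ R}) ≤ 2 ^ m := pow_le_pow_right₀ (by norm_num) h.le
      rw [one_div, inv_pow]
      rw [← div_eq_mul_inv, le_div_iff₀ (by positivity)]
      linarith
    · rw [ind_false h]; positivity
  calc (av fun u : ι → Λ => ind (Nat.card {i | u i ∈ R} < m))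
      ≤ av (fun u : ι → Λ => 2 ^ m * ∏ i, w (u i)) := av_mono hpt
    _ = 2 ^ m * av (fun u : ι → Λ => ∏ i, w (u i)) := av_mul _ _
    _ ≤ 2 ^ m * q ^ (Nat.card ι) := by gcongr
    _ ≤ 2 ^ m * q ^ n₀ := by
      gcongr 2 ^ m * ?_
      exact pow_le_pow_of_le_one hq0 hq1.le hι
    _ ≤ 2 ^ m * (ε / 2 ^ m) := by gcongr
    _ = ε := by field_simp

/-- Sampling lemma. -/
lemma sampling {Λ α : Type*} [Finite Λ] [Finite α] [Nonempty α] (e : α → Λ)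
    (he : Function.Injective e) (m : ℕ) (ε : ℝ) (hε : 0 < ε) :
    ∃ n₀ : ℕ, ∀ (ι : Type) [Finite ι], n₀ ≤ Nat.card ι →
      ∀ (f : (ι → Λ) → ℝ) (c : ℝ), (∀ u, f u ≤ 2) → 0 < c → c + 2 * ε ≤ av f →
      ∃ (J : Set ι) (z : ι → Λ), m ≤ Nat.card J ∧ c ≤ av fun x : J → α => f (glue e J z x) := by
  obtain ⟨n₀, hn₀⟩ := few_small (Set.range e) (Set.range_nonempty e) m ε hε
  refine ⟨n₀, fun ι _ hι f c hf hc h => ?_⟩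
  have : Nonempty Λ := ‹Nonempty α›.map e
  by_contra! hcon
  have h1 := hn₀ ι hι
  rw [resample e he f] at h
  obtain ⟨u, hu⟩ := exists_av_le (fun u : ι → Λ =>
    (av fun x : ({i | u i ∈ Set.range e} : Set ι) → α =>
      f (glue e {i | u i ∈ Set.range e} u x)) - 2 * ind (Nat.card {i | u i ∈ Set.range e} < m))
  rw [av_sub, av_mul] at hu
  by_cases hm : Nat.card {i | u i ∈ Set.range e} < m
  · rw [ind_true hm] at hu
    have h2 : (av fun x : ({i | u i ∈ Set.range e} : Set ι) → α =>
      f (glue e {i | u i ∈ Set.range e} u x)) ≤ 2 := by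
      calc _ ≤ av (fun x : ({i | u i ∈ Set.range e} : Set ι) → α => (2:ℝ)) := av_mono fun x => hf _
        _ = 2 := av_const 2
    linarith
  · rw [ind_false hm] at hu
    have := hcon _ u (not_lt.1 hm)
    linarith

end DHJ

namespace DHJ

open Combinatorics

/-- The set contains a combinatorial line. -/
def HasLine {ι α : Type} (A : Set (ι → α)) : Prop := ∃ l : Line α ι, ∀ a, l a ∈ A

/-- Density `δ` forces lines in high dimension. -/
def Good (α : Type) [Finite α] (δ : ℝ) : Prop :=
  ∃ n₀ : ℕ, ∀ (ι : Type) [Finite ι], n₀ ≤ Nat.card ι → ∀ A : Set (ι → α), δ ≤ dens A → HasLine A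

instance finite_line {ι α : Type} [Finite ι] [Finite α] : Finite (Line α ι) :=
  Finite.of_injective (fun l : Line α ι => l.idxFun) fun _ _ h => Line.ext h

instance finite_subspace {η ι α : Type} [Finite η] [Finite ι] [Finite α] :
    Finite (Subspace η α ι) :=
  Finite.of_injective (fun l : Subspace η α ι => l.idxFun) fun _ _ h => Subspace.ext h

lemma exists_split {ι : Type} [Finite ι] (n : ℕ) (h : n ≤ Nat.card ι) :
    ∃ k, n + k = Nat.card ι ∧ Nonempty ((Fin n ⊕ Fin k) ≃ ι) := by
  obtain ⟨k, hk⟩ := Nat.exists_eq_add_of_le h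
  refine ⟨k, hk.symm, ?_⟩
  have : Fintype ι := Fintype.ofFinite ι
  rw [Nat.card_eq_fintype_card] at hk
  exact ⟨finSumFinEquiv.trans (Fintype.equivFinOfCardEq hk).symm⟩

/-- Point of the cube obtained from two pieces. -/
def pt {ι κ₁ κ₂ α : Type} (e : (κ₁ ⊕ κ₂) ≃ ι) (x : κ₁ → α) (y : κ₂ → α) : ι → α :=
  fun i => Sum.elim x y (e.symm i)

lemma av_pt {ι κ₁ κ₂ α : Type} [Finite ι] [Finite κ₁] [Finite κ₂] [Finite α]
    (e : (κ₁ ⊕ κ₂) ≃ ι) (f : (ι → α) → ℝ) :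
    av f = av fun x : κ₁ → α => av fun y : κ₂ → α => f (pt e x y) := by
  rw [← av_equiv (Equiv.arrowCongr e (Equiv.refl α)), av_sumElim]
  rfl

lemma subspace_injective {η ι α : Type} (W : Subspace η α ι) : Function.Injective W := by
  intro x y h
  funext j
  obtain ⟨i, hi⟩ := W.proper j
  have := congrFun h i
  rwa [Subspace.apply_inr hi, Subspace.apply_inr hi] at this

/-- Composition of subspaces. -/
def compS {η κ ι α : Type} (W : Subspace κ α ι) (V : Subspace η α κ) : Subspace η α ι where
  idxFun i := Sum.elim Sum.inl V.idxFun (W.idxFun i)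
  proper j := by
    obtain ⟨k, hk⟩ := V.proper j
    obtain ⟨i, hi⟩ := W.proper k
    exact ⟨i, by simp [hi, hk]⟩

lemma compS_apply {η κ ι α : Type} (W : Subspace κ α ι) (V : Subspace η α κ) (x : η → α) :
    compS W V x = W (V x) := by
  funext i
  simp only [Subspace.apply_def, compS]
  rcases h : W.idxFun i with a | k
  · simp
  · simp [Subspace.apply_def]

/-- Point image of a line under a subspace. -/
def compL {κ ι α : Type} (W : Subspace κ α ι) (l : Line α κ) : Line α ι where
  idxFun i := Sum.elim some l.idxFun (W.idxFun i)
  proper := by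
    obtain ⟨k, hk⟩ := l.proper
    obtain ⟨i, hi⟩ := W.proper k
    exact ⟨i, by simp [hi, hk]⟩

lemma compL_apply {κ ι α : Type} (W : Subspace κ α ι) (l : Line α κ) (x : α) :
    compL W l x = W (l x) := by
  funext i
  simp only [Subspace.apply_def, compL, Line.apply_def]
  rcases h : W.idxFun i with a | k
  · simp
  · simp

/-- A subspace in the first block and a point in the second block. -/
def extS {η κ₁ κ₂ ι α : Type} (e : (κ₁ ⊕ κ₂) ≃ ι) (W : Subspace η α κ₁) (y : κ₂ → α) :
    Subspace η α ι where
  idxFun i := Sum.elim W.idxFun (fun j => Sum.inl (y j)) (e.symm i)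
  proper j := by
    obtain ⟨k, hk⟩ := W.proper j
    exact ⟨e (Sum.inl k), by simp [hk]⟩

lemma extS_apply {η κ₁ κ₂ ι α : Type} (e : (κ₁ ⊕ κ₂) ≃ ι) (W : Subspace η α κ₁) (y : κ₂ → α)
    (x : η → α) : extS e W y x = pt e (W x) y := by
  funext i
  simp only [Subspace.apply_def, extS, pt]
  rcases h : e.symm i with a | k <;> simp [Subspace.apply_def]

/-- A point in the first block and a subspace in the second block. -/
def extS' {η κ₁ κ₂ ι α : Type} (e : (κ₁ ⊕ κ₂) ≃ ι) (y : κ₁ → α) (W : Subspace η α κ₂) :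
    Subspace η α ι where
  idxFun i := Sum.elim (fun j => Sum.inl (y j)) W.idxFun (e.symm i)
  proper j := by
    obtain ⟨k, hk⟩ := W.proper j
    exact ⟨e (Sum.inr k), by simp [hk]⟩

lemma extS'_apply {η κ₁ κ₂ ι α : Type} (e : (κ₁ ⊕ κ₂) ≃ ι) (y : κ₁ → α) (W : Subspace η α κ₂)
    (x : η → α) : extS' e y W x = pt e y (W x) := by
  funext i
  simp only [Subspace.apply_def, extS', pt]
  rcases h : e.symm i with a | k <;> simp [Subspace.apply_def]

/-- A line in the first block and a subspace in the second block. -/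
def consS {m : ℕ} {κ₁ κ₂ ι α : Type} (e : (κ₁ ⊕ κ₂) ≃ ι) (l : Line α κ₁)
    (W : Subspace (Fin m) α κ₂) : Subspace (Fin (m + 1)) α ι where
  idxFun i := Sum.elim (fun j => (l.idxFun j).elim (Sum.inr 0) Sum.inl)
    (fun j => (W.idxFun j).map id Fin.succ) (e.symm i)
  proper j := by
    refine Fin.cases ?_ (fun j => ?_) j
    · obtain ⟨k, hk⟩ := l.proper
      exact ⟨e (Sum.inl k), by simp [hk]⟩
    · obtain ⟨k, hk⟩ := W.proper j
      exact ⟨e (Sum.inr k), by simp [hk]⟩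

lemma consS_apply {m : ℕ} {κ₁ κ₂ ι α : Type} (e : (κ₁ ⊕ κ₂) ≃ ι) (l : Line α κ₁)
    (W : Subspace (Fin m) α κ₂) (x : Fin (m + 1) → α) :
    consS e l W x = pt e (l (x 0)) (W (fun j => x j.succ)) := by
  funext i
  simp only [Subspace.apply_def, consS, pt]
  rcases h : e.symm i with a | k
  · rcases h' : l.idxFun a with _ | b <;> simp [h']
  · rcases h' : W.idxFun k with _ | b <;> simp [h', Subspace.apply_def]

lemma mdhj {α : Type} [Finite α] [Nonempty α] (h : ∀ δ > 0, Good α δ) (m : ℕ) :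
    ∀ δ > (0:ℝ), ∃ n₀ : ℕ, ∀ (ι : Type) [Finite ι], n₀ ≤ Nat.card ι →
      ∀ A : Set (ι → α), δ ≤ dens A → ∃ W : Subspace (Fin m) α ι, ∀ x, W x ∈ A := by
  induction m with
  | zero =>
    intro δ hδ
    refine ⟨0, fun ι _ _ A hA => ?_⟩
    obtain ⟨p, hp⟩ := exists_av_le (fun x : ι → α => ind (x ∈ A))
    have hpA : p ∈ A := by
      by_contra hn
      rw [ind_false hn] at hp
      have : dens A = av (fun x : ι → α => ind (x ∈ A)) := rfl
      linarith
    exact ⟨⟨fun i => Sum.inl (p i), fun j => j.elim0⟩, fun x => hpA⟩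
  | succ m ih =>
    intro δ hδ
    obtain ⟨n₁, h₁⟩ := h (δ / 2) (by linarith)
    obtain ⟨n₂, h₂⟩ := ih (δ / 2 / (Nat.card (Line α (Fin n₁)) + 1)) (by positivity)
    refine ⟨n₁ + n₂, fun ι _ hι A hA => ?_⟩
    obtain ⟨k, hk, ⟨e⟩⟩ := exists_split (ι := ι) n₁ (by omega)
    unfold dens at hA
    rw [av_pt e] at hA
    obtain ⟨l, hl⟩ := pigeon δ hδ (fun (x : Fin n₁ → α) (y : Fin k → α) => pt e x y ∈ A)
      (fun (l : Line α (Fin n₁)) x => ∃ a, x = l a)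
      (fun y hy => by
        obtain ⟨l, hl⟩ := h₁ (Fin n₁) (by simp) _ hy
        exact ⟨l, by rintro x ⟨a, rfl⟩; exact hl a⟩) hA
    obtain ⟨W, hW⟩ := h₂ (Fin k) (by simp; omega) _ hl
    refine ⟨consS e l W, fun x => ?_⟩
    rw [consS_apply]
    exact hW _ _ ⟨_, rfl⟩

/-- Replace the new letter by the letter `i`. -/
def rep {β : Type} (i : β) (a : Option β) : Option β := some (a.getD i)

lemma rep_rep {β : Type} (i : β) (a : Option β) : rep i (rep i a) = rep i a := rfl

/-- Insensitive sets. -/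
def Insens {β ι : Type} (i : β) (S : Set (ι → Option β)) : Prop :=
  ∀ x, x ∈ S ↔ (fun c => rep i (x c)) ∈ S

lemma Insens.congr {β ι : Type} {i : β} {S : Set (ι → Option β)} (h : Insens i S)
    {x y : ι → Option β} (hxy : ∀ c, rep i (x c) = rep i (y c)) : x ∈ S ↔ y ∈ S := by
  rw [h x, h y, funext hxy]

lemma rep_subspace {β η ι : Type} (i : β) (W : Subspace η (Option β) ι) (x : η → Option β) (c : ι) :
    rep i (W x c) = rep i (W (fun j => rep i (x j)) c) := by
  simp only [Subspace.apply_def]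
  rcases h : W.idxFun c with a | k
  · rfl
  · simp [rep_rep]

lemma insens_contains {β : Type} [Finite β] [Nonempty β] (h : ∀ δ > 0, Good β δ) (m : ℕ) (ε : ℝ)
    (hε : 0 < ε) : ∃ n₀ : ℕ, ∀ (ι : Type) [Finite ι], n₀ ≤ Nat.card ι →
      ∀ (i : β) (S : Set (ι → Option β)), Insens i S → ε ≤ dens S →
      ∃ W : Subspace (Fin m) (Option β) ι, ∀ x, W x ∈ S := by
  obtain ⟨n₁, h₁⟩ := mdhj h m (ε / 2) (by linarith)
  obtain ⟨n₀, h₀⟩ := sampling (some : β → Option β) (Option.some_injective β) n₁ (ε / 4)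
    (by linarith)
  refine ⟨n₀, fun ι _ hι i S hS hd => ?_⟩
  obtain ⟨J, z, hJ, hz⟩ := h₀ ι hι (fun u => ind (u ∈ S)) (ε / 2)
    (fun u => (ind_le_one _).trans (by norm_num)) (by linarith)
    (by unfold dens at hd; linarith)
  obtain ⟨V, hV⟩ := h₁ J hJ {x | glue some J z x ∈ S} hz
  classical
  let W : Subspace (Fin m) (Option β) ι :=
    { idxFun := fun c => if hc : c ∈ J then (V.idxFun ⟨c, hc⟩).map some id else Sum.inl (z c)
      proper := by
        intro j
        obtain ⟨c, hc⟩ := V.proper j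
        exact ⟨c, by simp [hc]⟩ }
  refine ⟨W, fun x => ?_⟩
  have h3 := hV (fun j => (x j).getD i)
  refine (hS.congr fun c => ?_).1 h3
  simp only [Subspace.apply_def, W]
  by_cases hc : c ∈ J
  · rw [glue_mem _ _ _ _ _ hc]
    simp only [hc, dif_pos]
    rcases h' : V.idxFun ⟨c, hc⟩ with a | k
    · simp [Subspace.apply_def, h', rep]
    · simp [Subspace.apply_def, h', rep]
  · rw [glue_not_mem _ _ _ _ _ hc]
    simp [hc]

lemma av_range {P X : Type*} [Finite P] [Finite X] [Nonempty P] (φ : P → X)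
    (hφ : Function.Injective φ) (g : X → ℝ) :
    (av fun x => ind (x ∈ Set.range φ) * g x) =
      ((Nat.card P : ℝ) / Nat.card X) * av fun p => g (φ p) := by
  classical
  have : Fintype X := Fintype.ofFinite X
  have : Fintype P := Fintype.ofFinite P
  rw [av_eq, av_eq]
  have h1 : ∑ x, ind (x ∈ Set.range φ) * g x = ∑ p, g (φ p) := by
    rw [← Finset.sum_image (s := Finset.univ) (g := φ) (f := g) (fun a _ b _ hab => hφ hab)]
    rw [← Finset.sum_subset (Finset.subset_univ (Finset.univ.image φ))]
    · refine Finset.sum_congr rfl fun x hx => ?_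
      rw [ind_true, one_mul]
      simpa using hx
    · intro x _ hx
      rw [ind_false, zero_mul]
      simpa using hx
  have h2 : (0:ℝ) < Fintype.card P := by exact_mod_cast Fintype.card_pos
  rw [h1, Nat.card_eq_fintype_card, Nat.card_eq_fintype_card]
  field_simp

end DHJ

namespace DHJ

open Combinatorics

lemma pt_rep {β κ₁ κ₂ ι : Type} (i : β) (e : (κ₁ ⊕ κ₂) ≃ ι) (x : κ₁ → Option β)
    (y : κ₂ → Option β) (c : ι) :
    rep i (pt e x y c) = rep i (pt e x (fun j => rep i (y j)) c) := by
  simp only [pt]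
  rcases e.symm c with a | k <;> simp [rep_rep]

lemma claim {β : Type} [Finite β] [Nonempty β] (h : ∀ δ > 0, Good β δ) (m : ℕ) (ε : ℝ)
    (hε : 0 < ε) : ∃ (M : ℕ) (κ : ℝ), 0 < κ ∧ κ ≤ 1 ∧ ∀ (t : ℕ) (ι : Type) [Finite ι],
      t * M ≤ Nat.card ι → ∀ (i : β) (S : Set (ι → Option β)) (g : (ι → Option β) → ℝ),
      Insens i S → (∀ x, g x ≤ 1) →
      (∀ W : Subspace (Fin m) (Option β) ι, (∀ x, W x ∈ S) → (av fun x => g (W x)) ≤ 0) →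
      (av fun x => ind (x ∈ S) * g x) ≤ ε + (1 - κ) ^ t * dens S := by
  obtain ⟨M, hM⟩ := insens_contains h m (ε / 2) (by linarith)
  set c : ℝ := (Nat.card (Fin m → Option β) : ℝ) / Nat.card (Fin M → Option β) with hc
  have hc0 : 0 < c := by
    have h1 : (0:ℝ) < Nat.card (Fin m → Option β) := by exact_mod_cast Nat.card_pos
    have h2 : (0:ℝ) < Nat.card (Fin M → Option β) := by exact_mod_cast Nat.card_pos
    positivity
  set κ₀ : ℝ := c * (ε / 2 / (Nat.card (Subspace (Fin m) (Option β) (Fin M)) + 1)) with hκ₀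
  have hκ₀0 : 0 < κ₀ := by positivity
  refine ⟨M, min 1 κ₀, lt_min one_pos hκ₀0, min_le_left _ _, ?_⟩
  set κ := min 1 κ₀ with hκ
  have hκ1 : 0 ≤ 1 - κ := by have := min_le_left 1 κ₀; linarith
  have hκ2 : κ ≤ κ₀ := min_le_right _ _
  have hκ3 : 0 < κ := lt_min one_pos hκ₀0
  intro t
  induction t with
  | zero =>
    intro ι _ _ i S g hS hg hW
    have : (av fun x => ind (x ∈ S) * g x) ≤ dens S := av_mono fun x => by
      have := ind_nonneg (x ∈ S); nlinarith [hg x]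
    simp; linarith
  | succ t ih =>
    intro ι _ hι i S g hS hg hW
    by_cases hd : dens S ≤ ε
    · have : (av fun x => ind (x ∈ S) * g x) ≤ dens S := av_mono fun x => by
        have := ind_nonneg (x ∈ S); nlinarith [hg x]
      have h2 : 0 ≤ (1 - κ) ^ (t + 1) * dens S := mul_nonneg (by positivity) (dens_nonneg S)
      linarith
    push Not at hd
    have hι' : t * M + M ≤ Nat.card ι := by rw [← Nat.succ_mul]; exact hι
    obtain ⟨k, hk, ⟨e⟩⟩ := exists_split (ι := ι) M (by omega)
    have hSpt : ∀ x y, pt e x y ∈ S ↔ pt e x (fun j => rep i (y j)) ∈ S := fun x y =>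
      hS.congr (pt_rep i e x y)
    have hdS : dens S = av fun x : Fin M → Option β => av fun y : Fin k → Option β =>
      ind (pt e x y ∈ S) := by unfold dens; rw [av_pt e]
    obtain ⟨U, hU⟩ := pigeon ε hε (fun (x : Fin M → Option β) (y : Fin k → Option β) => pt e x y ∈ S)
      (fun (U : Subspace (Fin m) (Option β) (Fin M)) x => x ∈ Set.range U)
      (fun y hy => by
        obtain ⟨W, hW⟩ := hM (Fin M) (by simp) i {x | pt e x y ∈ S} (fun x => by
          refine hS.congr fun c => ?_
          simp only [pt]
          rcases e.symm c with a | k <;> simp [rep_rep]) hy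
        exact ⟨W, by rintro x ⟨a, rfl⟩; exact hW a⟩) (by rw [← hdS]; exact hd.le)
    set T : Set (Fin k → Option β) := {y | ∀ x, x ∈ Set.range U → pt e x y ∈ S} with hT
    have hTi : Insens i T := by
      intro y
      simp only [hT, Set.mem_setOf_eq]
      refine forall_congr' fun x => ?_
      rw [hSpt x y]
    let R : (Fin M → Option β) → Set (Fin k → Option β) := fun x =>
      {y | pt e x y ∈ S ∧ ¬ (x ∈ Set.range U ∧ y ∈ T)}
    have hRi : ∀ x, Insens i (R x) := by
      intro x y
      simp only [R, Set.mem_setOf_eq]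
      rw [hSpt x y, hTi y]
    have hsplit : ∀ x y, ind (pt e x y ∈ S) = ind (y ∈ R x) +
        ind (x ∈ Set.range U) * ind (y ∈ T) := by
      intro x y
      rw [← ind_and]
      by_cases h1 : x ∈ Set.range U ∧ y ∈ T
      · have h2 : pt e x y ∈ S := h1.2 x h1.1
        have h3 : y ∉ R x := fun h => h.2 h1
        rw [ind_true h1, ind_true h2, ind_false h3]; norm_num
      · rw [ind_false h1, add_zero]
        congr 1
        simp only [R, Set.mem_setOf_eq, h1, not_false_eq_true, and_true]
    -- density bookkeeping
    have hdens : (av fun x => dens (R x)) = dens S - c * dens T := by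
      have h1 : dens S = (av fun x => dens (R x)) +
          av fun x : Fin M → Option β => av fun y => ind (x ∈ Set.range U) * ind (y ∈ T) := by
        rw [hdS, ← av_add]
        congr 1; funext x
        unfold dens
        rw [← av_add]
        congr 1; funext y
        exact hsplit x y
      have h2 : (av fun x : Fin M → Option β => av fun y => ind (x ∈ Set.range U) * ind (y ∈ T))
          = c * dens T := by
        have h3 : ∀ x : Fin M → Option β, (av fun y => ind (x ∈ Set.range U) * ind (y ∈ T)) =
          ind (x ∈ Set.range U) * dens T := fun x => av_mul _ _
        simp only [h3]
        rw [av_range _ (subspace_injective U) (fun _ => dens T), av_const]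
      linarith
    have hmain : (av fun x => ind (x ∈ S) * g x) =
        (av fun x => av fun y => ind (y ∈ R x) * g (pt e x y)) +
        av fun y => ind (y ∈ T) * av fun x => ind (x ∈ Set.range U) * g (pt e x y) := by
      have h1 : (av fun y => ind (y ∈ T) * av fun x => ind (x ∈ Set.range U) * g (pt e x y)) =
          av fun x => av fun y => ind (x ∈ Set.range U) * ind (y ∈ T) * g (pt e x y) := by
        rw [av_comm]
        congr 1; funext y
        rw [← av_mul]
        congr 1; funext x
        ring
      rw [h1, av_pt e, ← av_add]
      congr 1; funext x
      rw [← av_add]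
      congr 1; funext y
      rw [hsplit x y]; ring
    have hsecond : (av fun y => ind (y ∈ T) * av fun x => ind (x ∈ Set.range U) * g (pt e x y))
        ≤ 0 := by
      have h1 : ∀ y, ind (y ∈ T) * (av fun x => ind (x ∈ Set.range U) * g (pt e x y)) ≤ 0 := by
        intro y
        by_cases hy : y ∈ T
        · rw [ind_true hy, one_mul, av_range _ (subspace_injective U) (fun x => g (pt e x y))]
          have h2 := hW (extS e U y) (fun x => by rw [extS_apply]; exact hy _ ⟨x, rfl⟩)
          simp only [extS_apply] at h2
          exact mul_nonpos_of_nonneg_of_nonpos hc0.le h2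
        · rw [ind_false hy, zero_mul]
      have h2 := av_mono h1
      rwa [av_const] at h2
    have hfirst : ∀ x, (av fun y => ind (y ∈ R x) * g (pt e x y)) ≤
        ε + (1 - κ) ^ t * dens (R x) := by
      intro x
      refine ih (Fin k) (by simp; omega) i (R x) (fun y => g (pt e x y)) (hRi x) (fun y => hg _) ?_
      intro W hWR
      have h2 := hW (extS' e x W) (fun z => by rw [extS'_apply]; exact (hWR z).1)
      simp only [extS'_apply] at h2
      exact h2
    have hfirst' := av_mono hfirst
    rw [av_add, av_const, av_mul, hdens] at hfirst'
    have hcT : κ ≤ c * dens T := by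
      refine hκ2.trans ?_
      rw [hκ₀]
      exact mul_le_mul_of_nonneg_left hU hc0.le
    have hd1 := dens_le_one S
    have hfin : dens S - c * dens T ≤ (1 - κ) * dens S := by nlinarith
    have hp : 0 ≤ (1 - κ) ^ t := by positivity
    have hq := mul_le_mul_of_nonneg_left hfin hp
    rw [hmain, pow_succ]
    nlinarith

lemma insens_step {β : Type} [Finite β] [Nonempty β] (h : ∀ δ > 0, Good β δ) (m : ℕ) (ε : ℝ)
    (hε : 0 < ε) : ∃ n₀ : ℕ, ∀ (ι : Type) [Finite ι], n₀ ≤ Nat.card ι →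
      ∀ (i : β) (S : Set (ι → Option β)) (g : (ι → Option β) → ℝ), Insens i S → (∀ x, g x ≤ 1) →
      4 * ε ≤ (av fun x => ind (x ∈ S) * g x) →
      ∃ W : Subspace (Fin m) (Option β) ι, (∀ x, W x ∈ S) ∧ ε ≤ av fun x => g (W x) := by
  obtain ⟨M, κ, hκ0, hκ1, hM⟩ := claim h m ε hε
  obtain ⟨t, ht⟩ := exists_pow_lt_of_lt_one hε (show 1 - κ < 1 by linarith)
  refine ⟨t * M, fun ι _ hι i S g hS hg hav => ?_⟩
  by_contra! hcon
  have h1 := hM t ι hι i S (fun x => g x - ε) hS (fun x => by linarith [hg x]) (fun W hW => by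
    have := hcon W hW
    rw [av_sub, av_const]; linarith)
  have h2 : (av fun x => ind (x ∈ S) * (g x - ε)) = (av fun x => ind (x ∈ S) * g x) - ε * dens S := by
    unfold dens
    rw [← av_mul, ← av_sub]
    congr 1; funext x; ring
  have h3 := dens_le_one S
  have h4 := dens_nonneg S
  have h5 : (1 - κ) ^ t * dens S ≤ ε * 1 := by gcongr
  have h6 : ε * dens S ≤ ε * 1 := by gcongr
  linarith

lemma insens_multi {β : Type} [Finite β] [Nonempty β] (h : ∀ δ > 0, Good β δ) (m : ℕ)
    (s : Finset β) : ∀ ε > (0:ℝ), ∃ n₀ : ℕ, ∀ (ι : Type) [Finite ι], n₀ ≤ Nat.card ι →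
      ∀ (S : β → Set (ι → Option β)) (g : (ι → Option β) → ℝ), (∀ i ∈ s, Insens i (S i)) →
      (∀ x, g x ≤ 1) → ε ≤ (av fun x => ind (∀ i ∈ s, x ∈ S i) * g x) →
      ∃ W : Subspace (Fin m) (Option β) ι, 0 ≤ av fun x => g (W x) := by
  classical
  induction s using Finset.induction_on with
  | empty =>
    intro ε hε
    obtain ⟨n₀, h₀⟩ := insens_step h m (ε / 4) (by linarith)
    refine ⟨n₀, fun ι _ hι S g hS hg hav => ?_⟩
    obtain ⟨W, _, hW⟩ := h₀ ι hι (Classical.arbitrary β) Set.univ g (fun x => by simp) hg (by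
      simp only [Finset.notMem_empty, false_imp_iff, implies_true] at hav
      simp only [Set.mem_univ]
      linarith)
    exact ⟨W, by linarith⟩
  | insert a s ha ih =>
    intro ε hε
    obtain ⟨n₁, h₁⟩ := ih (ε / 4) (by linarith)
    obtain ⟨n₀, h₀⟩ := insens_step h n₁ (ε / 4) (by linarith)
    refine ⟨n₀, fun ι _ hι S g hS hg hav => ?_⟩
    obtain ⟨W, hWS, hW⟩ := h₀ ι hι a (S a) (fun x => ind (∀ i ∈ s, x ∈ S i) * g x)
      (hS a (Finset.mem_insert_self a s)) (fun x => by
        have h1 := ind_nonneg (∀ i ∈ s, x ∈ S i)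
        have h2 := ind_le_one (∀ i ∈ s, x ∈ S i)
        nlinarith [hg x]) (by
        have h3 : ∀ x, ind (∀ i ∈ insert a s, x ∈ S i) * g x =
            ind (x ∈ S a) * (ind (∀ i ∈ s, x ∈ S i) * g x) := by
          intro x
          rw [← mul_assoc, ← ind_and, Finset.forall_mem_insert]
        simp only [h3] at hav
        linarith)
    obtain ⟨V, hV⟩ := h₁ (Fin n₁) (by simp) (fun i => {x | W x ∈ S i}) (fun x => g (W x))
      (fun i hi x => (hS i (Finset.mem_insert_of_mem hi)).congr fun c => rep_subspace i W x c)
      (fun x => hg _) hW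
    refine ⟨compS W V, ?_⟩
    simpa only [compS_apply] using hV

end DHJ

namespace DHJ

open Combinatorics

lemma Good.mono {α : Type} [Finite α] {δ δ' : ℝ} (h : Good α δ) (hle : δ ≤ δ') : Good α δ' := by
  obtain ⟨n₀, h₀⟩ := h
  exact ⟨n₀, fun ι _ hι A hA => h₀ ι hι A (hle.trans hA)⟩

lemma good_of_one_lt (α : Type) [Finite α] {δ : ℝ} (h : 1 < δ) : Good α δ :=
  ⟨0, fun ι _ _ A hA => absurd (dens_le_one A) (by linarith)⟩

/-- Critical density. -/
lemma exists_critical (α : Type) [Finite α] (hbad : ¬ ∀ δ > 0, Good α δ) :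
    ∃ δ : ℝ, 0 < δ ∧ δ ≤ 1 ∧ (∀ η > 0, Good α (δ + η)) ∧ (∀ η > 0, ¬ Good α (δ - η)) := by
  push Not at hbad
  obtain ⟨δ₀, hδ₀, hb⟩ := hbad
  have hlow : ∀ δ ∈ {δ | Good α δ}, δ₀ ≤ δ := fun δ hδ => by
    by_contra! hlt
    exact hb (Good.mono hδ hlt.le)
  have hne : {δ | Good α δ}.Nonempty := ⟨2, good_of_one_lt α (by norm_num)⟩
  have hbdd : BddBelow {δ | Good α δ} := ⟨δ₀, hlow⟩
  refine ⟨sInf {δ | Good α δ}, hδ₀.trans_le (le_csInf hne hlow), ?_, ?_, ?_⟩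
  · refine le_of_forall_pos_le_add fun ε hε => csInf_le hbdd (good_of_one_lt α (by linarith))
  · intro η hη
    obtain ⟨δ, hδ, hlt⟩ := exists_lt_of_csInf_lt hne
      (show sInf {δ | Good α δ} < sInf {δ | Good α δ} + η by linarith)
    exact Good.mono hδ hlt.le
  · intro η hη hg
    have := csInf_le hbdd hg
    linarith

lemma section_lower {X : Type*} [Finite X] [Nonempty X] (F : X → ℝ) (a b : ℝ) (hF : ∀ x, F x ≤ a)
    (hb : b ≤ av F) (x : X) : a - Nat.card X * (a - b) ≤ F x := by
  have : Fintype X := Fintype.ofFinite X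
  have h1 : (av fun x => a - F x) ≤ a - b := by rw [av_sub, av_const]; linarith
  rw [av_eq] at h1
  have h2 : (0:ℝ) < Fintype.card X := by exact_mod_cast Fintype.card_pos
  rw [div_le_iff₀ h2] at h1
  have h3 : a - F x ≤ ∑ x, (a - F x) :=
    Finset.single_le_sum (f := fun x => a - F x) (fun y _ => by linarith [hF y]) (Finset.mem_univ x)
  rw [Nat.card_eq_fintype_card]
  linarith

/-- Evaluate a label. -/
def lab {M : ℕ} {β : Type} (p : Fin M → Option β) (t : Fin M ⊕ β) : Option β := Sum.elim p some t

/-- The point with given data. -/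
def Pnt {M : ℕ} {β κ₁ κ₂ ι : Type} (e : ((Fin M ⊕ κ₁) ⊕ κ₂) ≃ ι) (p : Fin M → Option β)
    (u : κ₁ → Fin M ⊕ β) (y : κ₂ → Option β) : ι → Option β :=
  pt e (Sum.elim p (fun c => lab p (u c))) y

/-- The line obtained from a line over the smaller alphabet. -/
def bigLine {M : ℕ} {β κ₁ κ₂ ι : Type} (e : ((Fin M ⊕ κ₁) ⊕ κ₂) ≃ ι) (l : Line β (Fin M))
    (u : κ₁ → Fin M ⊕ β) (y : κ₂ → Option β) : Line (Option β) ι where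
  idxFun i := Sum.elim (Sum.elim (fun j => (l.idxFun j).map some)
    (fun c => Sum.elim (fun j => (l.idxFun j).map some) (fun b => some (some b)) (u c)))
    (fun j => some (y j)) (e.symm i)
  proper := by
    obtain ⟨j, hj⟩ := l.proper
    exact ⟨e (Sum.inl (Sum.inl j)), by simp [hj]⟩

lemma bigLine_none {M : ℕ} {β κ₁ κ₂ ι : Type} (e : ((Fin M ⊕ κ₁) ⊕ κ₂) ≃ ι) (l : Line β (Fin M))
    (u : κ₁ → Fin M ⊕ β) (y : κ₂ → Option β) : bigLine e l u y none = Pnt e l.idxFun u y := by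
  funext i
  simp only [Line.apply_def, bigLine, Pnt, pt]
  rcases e.symm i with (j | c) | j
  · rcases h : l.idxFun j <;> simp [h]
  · rcases h' : u c with j | b
    · rcases h : l.idxFun j <;> simp [lab, h, h']
    · simp [lab, h']
  · simp

lemma bigLine_some {M : ℕ} {β κ₁ κ₂ ι : Type} (e : ((Fin M ⊕ κ₁) ⊕ κ₂) ≃ ι) (l : Line β (Fin M))
    (u : κ₁ → Fin M ⊕ β) (y : κ₂ → Option β) (b : β) :
    bigLine e l u y (some b) = Pnt e (fun j => some (l b j)) u y := by
  funext i
  simp only [Line.apply_def, bigLine, Pnt, pt]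
  rcases e.symm i with (j | c) | j
  · rcases h : l.idxFun j <;> simp [h]
  · rcases h' : u c with j | b
    · rcases h : l.idxFun j <;> simp [lab, h, h']
    · simp [lab, h']
  · simp

/-- Embedding of the alphabet in the labels. -/
def emb {M : ℕ} {β : Type} (j₀ : Fin M) (a : Option β) : Fin M ⊕ β := a.elim (Sum.inl j₀) Sum.inr

lemma emb_injective {M : ℕ} {β : Type} (j₀ : Fin M) :
    Function.Injective (emb j₀ : Option β → Fin M ⊕ β) := by
  intro a b h
  rcases a with _ | a <;> rcases b with _ | b <;> simp_all [emb]

open Classical in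
/-- Transport a line on the sampled coordinates. -/
noncomputable def liftLine {M : ℕ} {β κ₁ κ₂ ι : Type} (e : ((Fin M ⊕ κ₁) ⊕ κ₂) ≃ ι)
    (l : Line β (Fin M)) (J : Set κ₁) (z : κ₁ → Fin M ⊕ β) (y : κ₂ → Option β)
    (l' : Line (Option β) J) : Line (Option β) ι where
  idxFun i := Sum.elim (Sum.elim (fun j => some (l.idxFun j))
    (fun c => if h : c ∈ J then l'.idxFun ⟨c, h⟩ else some (lab l.idxFun (z c))))
    (fun j => some (y j)) (e.symm i)
  proper := by
    obtain ⟨j, hj⟩ := l'.proper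
    exact ⟨e (Sum.inl (Sum.inr j)), by simp [hj]⟩

lemma liftLine_apply {M : ℕ} {β κ₁ κ₂ ι : Type} (e : ((Fin M ⊕ κ₁) ⊕ κ₂) ≃ ι)
    (l : Line β (Fin M)) (J : Set κ₁) (z : κ₁ → Fin M ⊕ β) (y : κ₂ → Option β)
    (l' : Line (Option β) J) (j₀ : Fin M) (hj₀ : l.idxFun j₀ = none) (a : Option β) :
    liftLine e l J z y l' a = Pnt e l.idxFun (glue (emb j₀) J z (l' a)) y := by
  funext i
  rw [Line.apply_def]
  simp only [liftLine, Pnt, pt]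
  rcases e.symm i with (j | c) | j
  · simp
  · by_cases hc : c ∈ J
    · simp only [Sum.elim_inl, Sum.elim_inr, dif_pos hc]
      rw [glue_mem _ _ _ _ _ hc, Line.apply_def]
      have key : ∀ a : Option β, a = lab l.idxFun (emb j₀ a) := by
        intro a
        rcases a with _ | b <;> simp [emb, lab, hj₀]
      exact key _
    · simp only [Sum.elim_inl, Sum.elim_inr, dif_neg hc]
      rw [glue_not_mem _ _ _ _ _ hc]
      simp
  · simp

lemma Pnt_insens {M : ℕ} {β κ₁ κ₂ ι : Type} (e : ((Fin M ⊕ κ₁) ⊕ κ₂) ≃ ι)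
    (l : Line β (Fin M)) (J : Set κ₁) (z : κ₁ → Fin M ⊕ β) (y : κ₂ → Option β)
    (j₀ : Fin M) (hj₀ : l.idxFun j₀ = none) (i : β) (x : J → Option β) :
    Pnt e (fun j => some (l i j)) (glue (emb j₀) J z x) y =
    Pnt e (fun j => some (l i j)) (glue (emb j₀) J z (fun c => rep i (x c))) y := by
  funext d
  simp only [Pnt, pt]
  rcases e.symm d with (j | c) | j
  · simp
  · by_cases hc : c ∈ J
    · simp only [Sum.elim_inl, Sum.elim_inr]
      rw [glue_mem _ _ _ _ _ hc, glue_mem _ _ _ _ _ hc]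
      rcases x ⟨c, hc⟩ with _ | b
      · simp [emb, lab, hj₀, rep]
      · simp [emb, lab, rep]
    · simp only [Sum.elim_inl, Sum.elim_inr]
      rw [glue_not_mem _ _ _ _ _ hc, glue_not_mem _ _ _ _ _ hc]
  · simp

lemma insens_compl {β ι : Type} {i : β} {S : Set (ι → Option β)} (h : Insens i S) :
    Insens i Sᶜ := fun x => not_congr (h x)

/-- Splitting the complement of an intersection of insensitive sets. -/
lemma split_compl {β X : Type} [Finite β] [Finite X] (D : β → Set X) (g : X → ℝ) (ε : ℝ)
    (h : ε ≤ av fun x => (1 - ind (∀ i, x ∈ D i)) * g x) (hε : 0 < ε) :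
    ∃ P : Set β, ε / Nat.card (Set β) ≤
      av fun x => ind (∀ i, (i ∈ P → x ∈ D i) ∧ (i ∉ P → x ∈ (D i)ᶜ)) * g x := by
  classical
  have : Fintype (Set β) := Fintype.ofFinite _
  have key : ∀ x, (1 - ind (∀ i, x ∈ D i)) =
      ∑ P ∈ Finset.univ.filter (fun P : Set β => P ≠ Set.univ),
        ind (∀ i, (i ∈ P → x ∈ D i) ∧ (i ∉ P → x ∈ (D i)ᶜ)) := by
    intro x
    have hcell : ∀ P : Set β, (∀ i, (i ∈ P → x ∈ D i) ∧ (i ∉ P → x ∈ (D i)ᶜ)) ↔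
        P = {i | x ∈ D i} := by
      intro P
      constructor
      · intro hP
        ext i
        constructor
        · exact (hP i).1
        · intro hi
          by_contra hn
          exact (hP i).2 hn hi
      · rintro rfl i
        exact ⟨fun h => h, fun h => h⟩
    simp only [hcell]
    by_cases hx : ∀ i, x ∈ D i
    · rw [ind_true hx, sub_self, eq_comm]
      refine Finset.sum_eq_zero fun P hP => ?_
      rw [ind_false]
      rintro rfl
      rw [Finset.mem_filter] at hP
      exact hP.2 (Set.eq_univ_of_forall hx)
    · rw [ind_false hx, sub_zero, Finset.sum_eq_single {i | x ∈ D i}]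
      · rw [ind_true rfl]
      · intro P _ hne
        exact ind_false hne
      · intro hn
        exfalso
        apply hn
        rw [Finset.mem_filter]
        refine ⟨Finset.mem_univ _, fun heq => hx fun i => ?_⟩
        have : i ∈ {i | x ∈ D i} := by rw [heq]; trivial
        exact this
  simp only [key, Finset.sum_mul] at h
  rw [av_sum] at h
  by_contra! hcon
  have hcard : (0:ℝ) < Fintype.card (Set β) := by exact_mod_cast Fintype.card_pos
  have hlt : ∑ P ∈ Finset.univ.filter (fun P : Set β => P ≠ Set.univ),
      (av fun x => ind (∀ i, (i ∈ P → x ∈ D i) ∧ (i ∉ P → x ∈ (D i)ᶜ)) * g x) < ε := by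
    have hne : (Finset.univ.filter (fun P : Set β => P ≠ Set.univ)).Nonempty := by
      by_contra hemp
      rw [Finset.not_nonempty_iff_eq_empty] at hemp
      rw [hemp] at h
      simp at h; linarith
    refine (Finset.sum_lt_sum_of_nonempty hne fun P _ => hcon P).trans_le ?_
    rw [Finset.sum_const, nsmul_eq_mul, Nat.card_eq_fintype_card]
    have h1 : ((Finset.univ.filter (fun P : Set β => P ≠ Set.univ)).card : ℝ) ≤
        Fintype.card (Set β) := by exact_mod_cast Finset.card_le_univ _
    calc _ ≤ (Fintype.card (Set β) : ℝ) * (ε / Fintype.card (Set β)) := by gcongr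
      _ = ε := by field_simp
  linarith

lemma dhj_step {β : Type} [Finite β] [Nonempty β] (h : ∀ δ > 0, Good β δ) :
    ∀ δ > 0, Good (Option β) δ := by
  by_contra hbad
  obtain ⟨δ, hδ0, hδ1, hgood, hnot⟩ := exists_critical _ hbad
  obtain ⟨M, hM⟩ := h (δ / 4) (by linarith)
  set θ : ℝ := δ / 2 / 2 / (Nat.card (Line β (Fin M)) + 1) with hθ
  have hθ0 : 0 < θ := by positivity
  have hθ1 : θ ≤ 1 := by
    rw [hθ, div_le_one (by positivity)]
    have : (0:ℝ) ≤ Nat.card (Line β (Fin M)) := by positivity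
    linarith
  have hδθ : 0 < δ * θ := by positivity
  have hδθ1 : δ * θ ≤ δ := by nlinarith
  obtain ⟨m₂, hm₂⟩ := hgood (δ * θ / 8) (by linarith)
  have hcs : (0:ℝ) < Nat.card (Set β) := by exact_mod_cast Nat.card_pos
  have : Fintype β := Fintype.ofFinite β
  obtain ⟨nJ, hnJ⟩ := insens_multi h m₂ Finset.univ (δ * θ / 8 / Nat.card (Set β)) (by positivity)
  -- the sampling threshold must not depend on the choice of the wildcard label
  have hsamp : ∃ m₁ : ℕ, ∀ j₀ : Fin M, ∀ (f : (Fin m₁ → Fin M ⊕ β) → ℝ) (c : ℝ),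
      (∀ u, f u ≤ 2) → 0 < c → c + 2 * (δ * θ / 4) ≤ av f →
      ∃ (J : Set (Fin m₁)) (z : Fin m₁ → Fin M ⊕ β), nJ ≤ Nat.card J ∧
        c ≤ av fun x : J → Option β => f (glue (emb j₀) J z x) := by
    choose n hn using fun j₀ : Fin M => sampling (emb j₀ : Option β → Fin M ⊕ β) (emb_injective j₀)
      nJ (δ * θ / 4) (by linarith)
    refine ⟨∑ j, n j, fun j₀ f c => hn j₀ (Fin (∑ j, n j)) ?_ f c⟩
    simp only [Nat.card_eq_fintype_card, Fintype.card_fin]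
    exact Finset.single_le_sum (f := n) (fun _ _ => Nat.zero_le _) (Finset.mem_univ j₀)
  obtain ⟨m₁, hm₁⟩ := hsamp
  obtain ⟨Q, hQ⟩ : ∃ Q : ℝ, Q = ((Nat.card (Fin M ⊕ Fin m₁ → Option β) : ℕ) : ℝ) := ⟨_, rfl⟩
  have hQ0 : 0 < Q := by rw [hQ]; exact_mod_cast Nat.card_pos
  set η : ℝ := δ * θ / 4 / (2 * Q) with hη
  have hη0 : 0 < η := by positivity
  obtain ⟨n', hn'⟩ := hgood η hη0
  have hA := hnot η hη0
  unfold Good at hA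
  push Not at hA
  obtain ⟨ι, hfin, hι, A, hAd, hAl⟩ := hA (M + m₁ + n')
  obtain ⟨k, hk, ⟨e'⟩⟩ := exists_split (ι := ι) (M + m₁) (by omega)
  let e : ((Fin M ⊕ Fin m₁) ⊕ Fin k) ≃ ι :=
    (Equiv.sumCongr finSumFinEquiv (Equiv.refl (Fin k))).trans e'
  have hsecle : ∀ x : Fin M ⊕ Fin m₁ → Option β,
      (av fun y : Fin k → Option β => ind (pt e x y ∈ A)) ≤ δ + η := by
    intro x
    by_contra! hlt
    obtain ⟨l, hl⟩ := hn' (Fin k) (by simp; omega) {y | pt e x y ∈ A} hlt.le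
    refine hAl ⟨compL (extS' e x default) l, fun a => ?_⟩
    rw [compL_apply, extS'_apply]
    exact hl a
  have hsec : ∀ x : Fin M ⊕ Fin m₁ → Option β,
      δ - δ * θ / 4 ≤ av fun y : Fin k → Option β => ind (pt e x y ∈ A) := by
    intro x
    unfold dens at hAd
    rw [av_pt e] at hAd
    have h1 := section_lower _ (δ + η) (δ - η) hsecle hAd x
    have h2 : Q * (δ + η - (δ - η)) = δ * θ / 4 := by
      rw [hη]; field_simp; ring
    rw [← hQ, h2] at h1
    linarith
  have hPnt : ∀ p : Fin M → Option β, δ - δ * θ / 4 ≤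
      av fun q : (Fin m₁ → Fin M ⊕ β) × (Fin k → Option β) => ind (Pnt e p q.1 q.2 ∈ A) := by
    intro p
    rw [av_prod]
    have : Nonempty (Fin M ⊕ β) := inferInstance
    have h1 := av_mono (fun u : Fin m₁ → Fin M ⊕ β => hsec (Sum.elim p (fun c => lab p (u c))))
    rw [av_const] at h1
    exact h1
  obtain ⟨l, hl⟩ := pigeon (δ / 2) (by linarith)
    (fun (p : Fin M → β) (q : (Fin m₁ → Fin M ⊕ β) × (Fin k → Option β)) =>
      Pnt e (fun j => some (p j)) q.1 q.2 ∈ A)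
    (fun (l : Line β (Fin M)) x => ∃ b, x = l b)
    (fun y hy => by
      obtain ⟨l, hl⟩ := hM (Fin M) (by simp) _ (le_trans (by linarith) hy)
      exact ⟨l, by rintro x ⟨a, rfl⟩; exact hl a⟩)
    (by
      have h1 := av_mono (fun p : Fin M → β => hPnt (fun j => some (p j)))
      rw [av_const] at h1
      exact le_trans (by linarith) h1)
  rw [← hθ] at hl
  obtain ⟨j₀, hj₀⟩ := l.proper
  -- combine the two densities
  let B : (Fin m₁ → Fin M ⊕ β) → (Fin k → Option β) → Prop := fun u y => Pnt e l.idxFun u y ∈ A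
  let D : (Fin m₁ → Fin M ⊕ β) → (Fin k → Option β) → Prop := fun u y =>
    ∀ i, Pnt e (fun j => some (l i j)) u y ∈ A
  have hBD : ∀ u y, ¬ (B u y ∧ D u y) := by
    rintro u y ⟨hB, hD⟩
    refine hAl ⟨bigLine e l u y, fun a => ?_⟩
    rcases a with _ | b
    · rw [bigLine_none]; exact hB
    · rw [bigLine_some]; exact hD b
  have hDd : θ ≤ av fun q : (Fin m₁ → Fin M ⊕ β) × (Fin k → Option β) => ind (D q.1 q.2) := by
    refine hl.trans (av_mono fun q => ind_mono fun hq i => ?_)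
    exact hq _ ⟨i, rfl⟩
  have htot : δ + δ * θ / 4 + 2 * (δ * θ / 4) ≤
      av fun q : (Fin m₁ → Fin M ⊕ β) × (Fin k → Option β) =>
        ind (B q.1 q.2) + δ * ind (D q.1 q.2) := by
    rw [av_add, av_mul]
    have h1 := hPnt l.idxFun
    have h2 := mul_le_mul_of_nonneg_left hDd hδ0.le
    have h3 : (av fun q : (Fin m₁ → Fin M ⊕ β) × (Fin k → Option β) => ind (B q.1 q.2)) =
      av fun q : (Fin m₁ → Fin M ⊕ β) × (Fin k → Option β) =>
        ind (Pnt e l.idxFun q.1 q.2 ∈ A) := rfl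
    rw [h3]
    linarith
  rw [av_prod, av_comm] at htot
  obtain ⟨y, hy⟩ := exists_av_le (fun y : Fin k → Option β => av fun u : Fin m₁ → Fin M ⊕ β =>
        ind (B u y) + δ * ind (D u y))
  obtain ⟨J, z, hJ, hz⟩ := hm₁ j₀ (fun u => ind (B u y) + δ * ind (D u y)) (δ + δ * θ / 4)
    (fun u => by
      have h1 := ind_le_one (B u y)
      have h2 := ind_le_one (D u y)
      have h3 := ind_nonneg (D u y)
      nlinarith) (by linarith) (htot.trans hy)
  let Dz : β → Set (J → Option β) := fun i =>
    {x | Pnt e (fun j => some (l i j)) (glue (emb j₀) J z x) y ∈ A}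
  have hDz : ∀ i, Insens i (Dz i) := by
    intro i x
    have := Pnt_insens e l J z y j₀ hj₀ i x
    show (Pnt e (fun j => some (l i j)) (glue (emb j₀) J z x) y ∈ A) ↔
      (Pnt e (fun j => some (l i j)) (glue (emb j₀) J z (fun c => rep i (x c))) y ∈ A)
    rw [this]
  let g : (J → Option β) → ℝ := fun x => ind (B (glue (emb j₀) J z x) y) - (δ + δ * θ / 8)
  have hg : δ * θ / 8 ≤ av fun x => (1 - ind (∀ i, x ∈ Dz i)) * g x := by
    have h1 : ∀ x, (ind (B (glue (emb j₀) J z x) y) + δ * ind (D (glue (emb j₀) J z x) y)) -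
        (δ + δ * θ / 8) ≤ (1 - ind (∀ i, x ∈ Dz i)) * g x := by
      intro x
      have h2 : ind (∀ i, x ∈ Dz i) = ind (D (glue (emb j₀) J z x) y) := rfl
      rw [h2]
      simp only [g]
      have h3 := hBD (glue (emb j₀) J z x) y
      by_cases hb : B (glue (emb j₀) J z x) y
      · have hd : ¬ D (glue (emb j₀) J z x) y := fun hd => h3 ⟨hb, hd⟩
        rw [ind_true hb, ind_false hd]
        linarith
      · rw [ind_false hb]
        by_cases hd : D (glue (emb j₀) J z x) y
        · rw [ind_true hd]; linarith
        · rw [ind_false hd]; linarith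
    have h2 := av_mono h1
    rw [av_sub, av_const] at h2
    linarith
  obtain ⟨P, hP⟩ := split_compl Dz g (δ * θ / 8) hg (by linarith)
  classical
  obtain ⟨W, hW⟩ := hnJ J hJ (fun i => if i ∈ P then Dz i else (Dz i)ᶜ) g
    (fun i _ => by
      by_cases hi : i ∈ P
      · simp only [hi, if_true]; exact hDz i
      · simp only [hi, if_false]; exact insens_compl (hDz i))
    (fun x => by
      have := ind_le_one (B (glue (emb j₀) J z x) y)
      simp only [g]; linarith)
    (by
      refine hP.trans (le_of_eq ?_)
      congr 1; funext x
      congr 2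
      apply propext
      constructor
      · intro hx i _
        by_cases hi : i ∈ P
        · simp only [hi, if_true]; exact (hx i).1 hi
        · simp only [hi, if_false]; exact (hx i).2 hi
      · intro hx i
        have := hx i (Finset.mem_univ i)
        constructor
        · intro hi; simpa only [hi, if_true] using this
        · intro hi; simpa only [hi, if_false] using this)
  simp only [g] at hW
  rw [av_sub, av_const] at hW
  obtain ⟨l', hl'⟩ := hm₂ (Fin m₂) (by simp) {x | B (glue (emb j₀) J z (W x)) y}
    (by unfold dens; exact le_of_sub_nonneg hW)
  refine hAl ⟨liftLine e l J z y (compL W l'), fun a => ?_⟩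
  rw [liftLine_apply e l J z y _ j₀ hj₀, compL_apply]
  exact hl' a

end DHJ

namespace DHJ

open Combinatorics

lemma good_unit : ∀ δ > 0, Good Unit δ := by
  intro δ hδ
  refine ⟨1, fun ι _ hι A hA => ?_⟩
  have hne : Nonempty ι := by
    by_contra hn
    rw [not_nonempty_iff] at hn
    simp at hι
  have hA' : ∃ x, x ∈ A := by
    by_contra! hcon
    have h1 : dens A = av fun _ : ι → Unit => (0:ℝ) := by
      unfold dens
      congr 1; funext x
      exact ind_false (hcon x)
    rw [av_const] at h1
    linarith
  obtain ⟨x, hx⟩ := hA'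
  obtain ⟨c⟩ := hne
  refine ⟨⟨fun _ => none, c, rfl⟩, fun a => ?_⟩
  convert hx

lemma dhj_all (n : ℕ) : ∃ (α : Type) (_ : Finite α), Nonempty (α ≃ Fin (n + 1)) ∧
    ∀ δ > 0, Good α δ := by
  induction n with
  | zero => exact ⟨Unit, inferInstance, ⟨Equiv.ofUnique Unit (Fin 1)⟩, good_unit⟩
  | succ n ih =>
    obtain ⟨α, _, ⟨e⟩, h⟩ := ih
    have : Nonempty α := ⟨e.symm 0⟩
    exact ⟨Option α, inferInstance, ⟨(Equiv.optionCongr e).trans (finSuccEquiv (n + 1)).symm⟩,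
      dhj_step h⟩

lemma szem (k : ℕ) (δ : ℝ) (hδ : 0 < δ) : ∃ N₀ : ℕ, ∀ N : ℕ, N₀ ≤ N → ∀ B : Finset ℤ,
    (∀ b ∈ B, 0 ≤ b ∧ b < N) → δ * N ≤ B.card →
    ∃ x d : ℤ, d ≠ 0 ∧ ∀ i : ℕ, i ≤ k → x + i * d ∈ B := by
  classical
  obtain ⟨α, hfin, ⟨e⟩, hα⟩ := dhj_all k
  obtain ⟨n, hn⟩ := hα (δ / 2) (by linarith)
  refine ⟨n * k + 1, fun N hN B hB hBc => ?_⟩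
  have : Nonempty α := ⟨e.symm 0⟩
  have hL : Nonempty (Fin (N + n * k)) := ⟨⟨0, by omega⟩⟩
  let s : (Fin n → α) → ℕ := fun x => ∑ c, (e (x c) : ℕ)
  have hs : ∀ x, s x ≤ n * k := by
    intro x
    have : s x ≤ ∑ _c : Fin n, k := Finset.sum_le_sum fun c _ => by omega
    simpa using this
  have hx : ∀ x, δ / 2 ≤ av fun j : Fin (N + n * k) => ind (((j : ℕ) : ℤ) - n * k + s x ∈ B) := by
    intro x
    rw [av_eq]
    have h1 : (B.card : ℝ) ≤ ∑ j : Fin (N + n * k), ind (((j : ℕ) : ℤ) - n * k + s x ∈ B) := by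
      have h2 : ∑ j : Fin (N + n * k), ind (((j : ℕ) : ℤ) - n * k + s x ∈ B) =
          ((Finset.univ.filter fun j : Fin (N + n * k) =>
            ((j : ℕ) : ℤ) - n * k + s x ∈ B).card : ℝ) := by
        rw [← Finset.sum_boole]
        refine Finset.sum_congr rfl fun j _ => ?_
        by_cases h : ((j : ℕ) : ℤ) - n * k + s x ∈ B
        · rw [ind_true h, if_pos h]
        · rw [ind_false h, if_neg h]
      rw [h2]
      have h3 : B ⊆ (Finset.univ.filter fun j : Fin (N + n * k) =>
            ((j : ℕ) : ℤ) - n * k + s x ∈ B).image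
            (fun j : Fin (N + n * k) => ((j : ℕ) : ℤ) - n * k + s x) := by
        intro b hb
        obtain ⟨hb0, hbN⟩ := hB b hb
        have hsx := hs x
        have hsx' : (s x : ℤ) ≤ n * k := by exact_mod_cast hsx
        have hj : (b + n * k - s x).toNat < N + n * k := by
          zify
          rw [Int.toNat_of_nonneg (by linarith)]
          have : (0:ℤ) ≤ s x := by positivity
          linarith
        have hj' : (((⟨(b + n * k - s x).toNat, hj⟩ : Fin (N + n * k)) : ℕ) : ℤ) - n * k + s x
            = b := by
          show (((b + n * k - s x).toNat : ℕ) : ℤ) - n * k + s x = b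
          rw [Int.toNat_of_nonneg (by linarith)]
          ring
        rw [Finset.mem_image]
        refine ⟨⟨(b + n * k - s x).toNat, hj⟩, ?_, hj'⟩
        rw [Finset.mem_filter]
        exact ⟨Finset.mem_univ _, by rw [hj']; exact hb⟩
      exact_mod_cast (Finset.card_le_card h3).trans Finset.card_image_le
    rw [Fintype.card_fin, le_div_iff₀ (by exact_mod_cast (by omega : 0 < N + n * k))]
    have h4 : ((N + n * k : ℕ) : ℝ) ≤ 2 * N := by
      have : N + n * k ≤ 2 * N := by omega
      exact_mod_cast this
    nlinarith
  have h1 := av_mono hx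
  rw [av_const, av_comm] at h1
  obtain ⟨j, hj⟩ := exists_av_le (fun j : Fin (N + n * k) =>
    av fun x : Fin n → α => ind (((j : ℕ) : ℤ) - n * k + s x ∈ B))
  obtain ⟨l, hl⟩ := hn (Fin n) (by simp) {x | ((j : ℕ) : ℤ) - n * k + s x ∈ B} (h1.trans hj)
  obtain ⟨c₀, hc₀⟩ := l.proper
  let x₀ : ℕ := ∑ c, (l.idxFun c).elim 0 (fun a => (e a : ℕ))
  let w : ℕ := (Finset.univ.filter fun c => l.idxFun c = none).card
  have hw : 0 < w := Finset.card_pos.2 ⟨c₀, by simp [hc₀]⟩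
  have hsl : ∀ a, s (l a) = x₀ + w * (e a : ℕ) := by
    intro a
    have h2 : w * (e a : ℕ) = ∑ c, if l.idxFun c = none then (e a : ℕ) else 0 := by
      rw [← Finset.sum_filter, Finset.sum_const, smul_eq_mul]
    rw [h2, ← Finset.sum_add_distrib]
    refine Finset.sum_congr rfl fun c _ => ?_
    rw [Line.apply_def]
    rcases h : l.idxFun c with _ | b <;> simp [h]
  refine ⟨((j : ℕ) : ℤ) - n * k + x₀, w, by exact_mod_cast hw.ne', fun i hi => ?_⟩
  have h3 := hl (e.symm ⟨i, by omega⟩)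
  have h4 : ((j : ℕ) : ℤ) - n * k + s (l (e.symm ⟨i, by omega⟩)) ∈ B := h3
  rw [hsl, Equiv.apply_symm_apply] at h4
  convert h4 using 1
  push_cast
  ring

open MeasureTheory in
lemma exists_lam_pos (E : Finset ℝ) (hE : ∀ d ∈ E, 0 < d) (ε : ℝ) (hε : 0 < ε) (hε1 : ε ≤ 1)
    (hEε : 4 * ε * E.card ≤ 1) : ∃ t : ℝ, ∀ d ∈ E, ∀ j : ℤ, ε ≤ |t * d - j| := by
  by_contra! hcon
  let S : ℝ := ∑ d ∈ E, 1 / d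
  have hS : 0 ≤ S := Finset.sum_nonneg fun d hd => by
    have := hE d hd
    positivity
  let T : ℝ := 32 * ε * S + 1
  have hT : 0 < T := by positivity
  have hsub : Set.Icc 0 T ⊆ ⋃ d ∈ E, ⋃ i ∈ Finset.range (⌈T * d⌉₊ + 3),
      Set.Ioo (((i : ℝ) - 1 - ε) / d) (((i : ℝ) - 1 + ε) / d) := by
    intro t ht
    obtain ⟨d, hd, j, hj⟩ := hcon t
    have hd0 := hE d hd
    rw [abs_lt] at hj
    have h1 : 0 ≤ t * d := mul_nonneg ht.1 hd0.le
    have h2 : t * d ≤ T * d := mul_le_mul_of_nonneg_right ht.2 hd0.le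
    have h3 : T * d ≤ ⌈T * d⌉₊ := Nat.le_ceil _
    have hj0 : -1 ≤ j := by
      have : (-2 : ℝ) < j := by linarith
      have : (-2 : ℤ) < j := by exact_mod_cast this
      omega
    have hj1 : j < ⌈T * d⌉₊ + 1 := by
      have : (j : ℝ) < ⌈T * d⌉₊ + 1 := by linarith
      exact_mod_cast this
    simp only [Set.mem_iUnion]
    refine ⟨d, hd, (j + 1).toNat, ?_, ?_⟩
    · rw [Finset.mem_range]; omega
    · have h4 : (((j + 1).toNat : ℕ) : ℝ) = j + 1 := by
        have : (((j + 1).toNat : ℕ) : ℤ) = j + 1 := Int.toNat_of_nonneg (by omega)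
        exact_mod_cast this
      rw [h4]
      constructor
      · rw [div_lt_iff₀ hd0]; linarith
      · rw [lt_div_iff₀ hd0]; linarith
  have hvol := measure_mono (μ := volume) hsub
  rw [Real.volume_Icc, sub_zero] at hvol
  have hb : ∀ d ∈ E, volume (⋃ i ∈ Finset.range (⌈T * d⌉₊ + 3),
      Set.Ioo (((i : ℝ) - 1 - ε) / d) (((i : ℝ) - 1 + ε) / d)) ≤
      ENNReal.ofReal (2 * ε * T + 8 * ε * (1 / d)) := by
    intro d hd
    have hd0 := hE d hd
    refine (measure_biUnion_finset_le _ _).trans ?_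
    have h1 : ∀ i ∈ Finset.range (⌈T * d⌉₊ + 3),
        volume (Set.Ioo (((i : ℝ) - 1 - ε) / d) (((i : ℝ) - 1 + ε) / d)) =
        ENNReal.ofReal (2 * ε / d) := by
      intro i _
      rw [Real.volume_Ioo]
      congr 1
      ring
    rw [Finset.sum_congr rfl h1, ← ENNReal.ofReal_sum_of_nonneg (fun _ _ => by positivity)]
    apply ENNReal.ofReal_le_ofReal
    rw [Finset.sum_const, Finset.card_range, nsmul_eq_mul]
    have h2 : (⌈T * d⌉₊ : ℝ) < T * d + 1 := Nat.ceil_lt_add_one (by positivity)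
    push_cast
    calc ((⌈T * d⌉₊ : ℝ) + 3) * (2 * ε / d) ≤ (T * d + 4) * (2 * ε / d) := by
          exact mul_le_mul_of_nonneg_right (by linarith) (by positivity)
      _ = 2 * ε * T + 8 * ε * (1 / d) := by field_simp; ring
  have h2 := hvol.trans ((measure_biUnion_finset_le _ _).trans (Finset.sum_le_sum hb))
  rw [← ENNReal.ofReal_sum_of_nonneg] at h2
  swap
  · intro d hd
    have := hE d hd
    positivity
  rw [Finset.sum_add_distrib, Finset.sum_const, ← Finset.mul_sum, nsmul_eq_mul] at h2
  have h5 : (0:ℝ) ≤ E.card * (2 * ε * T) + 8 * ε * S := by positivity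
  rw [ENNReal.ofReal_le_ofReal_iff h5] at h2
  have h6 : (E.card : ℝ) * (2 * ε * T) ≤ T / 2 := by nlinarith
  have h7 : T = 32 * ε * S + 1 := rfl
  have h8 : 0 ≤ ε * S := by positivity
  have h9 : ∑ d ∈ E, 1 / d = S := rfl
  linarith

lemma exists_lam (E : Finset ℝ) (hE : ∀ d ∈ E, d ≠ 0) (ε : ℝ) (hε : 0 < ε) (hε1 : ε ≤ 1)
    (hEε : 4 * ε * E.card ≤ 1) : ∃ t : ℝ, ∀ d ∈ E, ∀ j : ℤ, ε ≤ |t * d - j| := by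
  classical
  obtain ⟨t, ht⟩ := exists_lam_pos (E.image fun d => |d|)
    (by
      intro d hd
      rw [Finset.mem_image] at hd
      obtain ⟨d', hd', rfl⟩ := hd
      exact abs_pos.2 (hE d' hd')) ε hε hε1
    (by
      have : ((E.image fun d => |d|).card : ℝ) ≤ E.card := by exact_mod_cast Finset.card_image_le
      refine le_trans ?_ hEε
      gcongr)
  refine ⟨t, fun d hd j => ?_⟩
  have hm : |d| ∈ E.image fun d => |d| := Finset.mem_image_of_mem _ hd
  rcases abs_choice d with h | h
  · have := ht _ hm j
    rwa [h] at this
  · have := ht _ hm (-j)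
    rw [h] at this
    rw [← abs_neg]
    convert this using 2
    push_cast
    ring

lemma pluen (A : Finset ℝ) (hA : A.Nonempty) (K : ℝ) (h : ((A + A).card : ℝ) ≤ K * A.card) :
    (((2 • A - 2 • A : Finset ℝ)).card : ℝ) ≤ K ^ 4 * A.card := by
  have h1 := Finset.pluennecke_ruzsa_inequality_nsmul_sub_nsmul_add hA A 2 2
  have h2 : (((2 • A - 2 • A : Finset ℝ)).card : ℝ) ≤
      (((A + A).card : ℝ) / A.card) ^ (2 + 2) * A.card := by
    have h3 := (NNRat.cast_le (K := ℝ)).2 h1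
    push_cast at h3
    exact h3
  have hc : (0:ℝ) < A.card := by exact_mod_cast hA.card_pos
  refine h2.trans ?_
  gcongr
  rwa [div_le_iff₀ hc]

end DHJ

open DHJ

/-- For every real `K > 0` and every integer `k ≥ 3` there is a threshold
`n₀ = n₀(K, k)` such that: if `A` is a finite set of reals with `|A| = n ≥ n₀` and
`|A + A| ≤ K·|A|`, then `A` contains a `k`-term arithmetic progression. -/
theorem stmt_11 (K : ℝ) (hK : 0 < K) (k : ℕ) (hk : 3 ≤ k) :
    ∃ n₀ : ℕ, ∀ A : Finset ℝ,
      n₀ ≤ A.card →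
      ((A + A).card : ℝ) ≤ K * (A.card : ℝ) →
      ∃ x d : ℝ, d ≠ 0 ∧ ∀ i : ℕ, i ≤ k - 1 → x + (i : ℝ) * d ∈ A := by
  classical
  let C : ℕ := ⌈K ^ 4⌉₊ + 1
  have hC : K ^ 4 ≤ C := (Nat.le_ceil _).trans (by simp [C])
  have hC0 : 0 < C := Nat.succ_pos _
  have hCr : (0:ℝ) < C := by exact_mod_cast hC0
  obtain ⟨N₀, hN₀⟩ := szem (k - 1) (1 / (8 * C)) (by positivity)
  refine ⟨N₀ + 1, fun A hA hAA => ?_⟩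
  have hAc : 0 < A.card := by omega
  have hAcr : (0:ℝ) < A.card := by exact_mod_cast hAc
  have hP := pluen A (Finset.card_pos.1 hAc) K hAA
  let E : Finset ℝ := (2 • A - 2 • A : Finset ℝ).erase 0
  let N : ℕ := 8 * C * A.card
  have hNr : (N : ℝ) = 8 * C * A.card := by simp [N]
  have hN0 : (0:ℝ) < N := by rw [hNr]; positivity
  have hEc : (E.card : ℝ) ≤ C * A.card := by
    have h1 : (E.card : ℝ) ≤ (2 • A - 2 • A : Finset ℝ).card := by
      exact_mod_cast Finset.card_erase_le
    refine h1.trans (hP.trans ?_)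
    gcongr
  have hN8 : 8 ≤ N := by
    have : 0 < C * A.card := Nat.mul_pos hC0 hAc
    simp only [N]
    nlinarith
  have hNA : A.card ≤ N := by
    simp only [N]
    nlinarith
  obtain ⟨t, ht⟩ := exists_lam E (fun d hd => Finset.ne_of_mem_erase hd) (2 / N) (by positivity)
    (by
      rw [div_le_one hN0]
      have : 2 ≤ N := by omega
      exact_mod_cast this)
    (by
      have : 4 * (2 / (N:ℝ)) * E.card = 8 * E.card / N := by ring
      rw [this, div_le_one hN0, hNr]
      linarith)
  let b : ℝ → ℤ := fun a => ⌊(N : ℝ) * Int.fract (t * a)⌋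
  have key : ∀ a₀ ∈ A, ∀ a₁ ∈ A, ∀ a₂ ∈ A, b a₀ + b a₂ = 2 * b a₁ → a₀ + a₂ = 2 * a₁ := by
    intro a₀ h₀ a₁ h₁ a₂ h₂ hb
    by_contra hne
    have hmem : a₀ + a₂ - (a₁ + a₁) ∈ E := by
      refine Finset.mem_erase.2 ⟨fun h => hne (by linarith), ?_⟩
      rw [two_nsmul]
      exact Finset.sub_mem_sub (Finset.add_mem_add h₀ h₂) (Finset.add_mem_add h₁ h₁)
    have h3 := ht _ hmem (⌊t * a₀⌋ + ⌊t * a₂⌋ - 2 * ⌊t * a₁⌋)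
    have hbr : (b a₀ : ℝ) + b a₂ = 2 * b a₁ := by exact_mod_cast hb
    have e0 := Int.floor_add_fract (t * a₀)
    have e1 := Int.floor_add_fract (t * a₁)
    have e2 := Int.floor_add_fract (t * a₂)
    have l0 : (b a₀ : ℝ) ≤ N * Int.fract (t * a₀) := Int.floor_le _
    have l1 : (b a₁ : ℝ) ≤ N * Int.fract (t * a₁) := Int.floor_le _
    have l2 : (b a₂ : ℝ) ≤ N * Int.fract (t * a₂) := Int.floor_le _
    have u0 : N * Int.fract (t * a₀) < b a₀ + 1 := Int.lt_floor_add_one _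
    have u1 : N * Int.fract (t * a₁) < b a₁ + 1 := Int.lt_floor_add_one _
    have u2 : N * Int.fract (t * a₂) < b a₂ + 1 := Int.lt_floor_add_one _
    have h4 : t * (a₀ + a₂ - (a₁ + a₁)) - ((⌊t * a₀⌋ + ⌊t * a₂⌋ - 2 * ⌊t * a₁⌋ : ℤ) : ℝ) =
        Int.fract (t * a₀) + Int.fract (t * a₂) - 2 * Int.fract (t * a₁) := by
      push_cast
      linarith
    rw [h4, div_le_iff₀ hN0] at h3
    have h5 : |Int.fract (t * a₀) + Int.fract (t * a₂) - 2 * Int.fract (t * a₁)| * N =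
        |N * Int.fract (t * a₀) + N * Int.fract (t * a₂) - 2 * (N * Int.fract (t * a₁))| := by
      nth_rewrite 1 [← abs_of_pos hN0]
      rw [← abs_mul]
      congr 1
      ring
    rw [h5] at h3
    have h6 : |N * Int.fract (t * a₀) + N * Int.fract (t * a₂) -
        2 * (N * Int.fract (t * a₁))| < 2 := by
      rw [abs_lt]
      constructor <;> linarith
    linarith
  have hinj : Set.InjOn b A := by
    intro a ha a' ha' h
    have := key a ha a' ha' a' ha' (by rw [h]; ring)
    linarith
  obtain ⟨x, d, hd, hx⟩ := hN₀ N (by omega) (A.image b)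
    (by
      intro z hz
      rw [Finset.mem_image] at hz
      obtain ⟨a, _, rfl⟩ := hz
      constructor
      · exact Int.floor_nonneg.2 (mul_nonneg hN0.le (Int.fract_nonneg _))
      · rw [Int.floor_lt]
        have := Int.fract_lt_one (t * a)
        push_cast
        nlinarith)
    (by
      rw [Finset.card_image_of_injOn hinj, hNr]
      apply le_of_eq
      field_simp)
  have hex : ∀ i : ℕ, ∃ a, i ≤ k - 1 → a ∈ A ∧ b a = x + i * d := by
    intro i
    by_cases hi : i ≤ k - 1
    · obtain ⟨a, ha, hab⟩ := Finset.mem_image.1 (hx i hi)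
      exact ⟨a, fun _ => ⟨ha, hab⟩⟩
    · exact ⟨0, fun h => absurd h hi⟩
  choose a ha using hex
  have hrec : ∀ i : ℕ, i + 2 ≤ k - 1 → a i + a (i + 2) = 2 * a (i + 1) := by
    intro i hi
    have h0 := ha i (by omega)
    have h1 := ha (i + 1) (by omega)
    have h2 := ha (i + 2) (by omega)
    refine key _ h0.1 _ h1.1 _ h2.1 ?_
    rw [h0.2, h1.2, h2.2]
    push_cast
    ring
  have hform : ∀ i : ℕ, (i ≤ k - 1 → a i = a 0 + i * (a 1 - a 0)) ∧
      (i + 1 ≤ k - 1 → a (i + 1) = a 0 + (i + 1) * (a 1 - a 0)) := by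
    intro i
    induction i with
    | zero => constructor <;> intro _ <;> simp
    | succ i ih =>
      refine ⟨fun h => ?_, fun h => ?_⟩
      · rw [ih.2 h]; push_cast; ring
      · have h1 := hrec i h
        have h2 := ih.1 (by omega)
        have h3 := ih.2 (by omega)
        rw [h2, h3] at h1
        push_cast
        linarith
  refine ⟨a 0, a 1 - a 0, ?_, fun i hi => ?_⟩
  · intro h
    have h0 := (ha 0 (by omega)).2
    have h1 := (ha 1 (by omega)).2
    have h2 : a 1 = a 0 := by linarith
    rw [h2, h0] at h1
    push_cast at h1
    apply hd
    linarith
  · rw [← (hform i).1 hi]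
    exact (ha i hi).1
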